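/- In the model A of O₂ ⊗ O₃, for every x ∈ A the scalar φ(x)·1 lies in the norm closure of the convex hull of {u x u* : u a unitary in F}, where F is the C*-subalgebra of A generated by {S_μ S_ν* T_α T_β* : |μ| = |ν|, |α| = |β|}. -/

import Mathlib

open scoped ComplexOrder

/-- The word `S_μ = S_{μ₁} ⋯ S_{μ_k}` associated to a multi-index `μ`. -/
def cuntzWord {A : Type*} [Monoid A] {n : ℕ} (S : Fin n → A) (μ : List (Fin n)) : A :=
  (μ.map S).prod

/-- A state on a C*-algebra: a positive continuous linear functional of norm one. -/
def IsState {A : Type*} [CStarAlgebra A] (f : A →L[ℂ] ℂ) : Prop :=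
  ‖f‖ = 1 ∧ ∀ a : A, 0 ≤ f (star a * a)

/-- The defining property of the canonical state `φ = φ₂ ⊗ φ₃` on the model `A` of `O₂ ⊗ O₃`:
`φ(S_μ S_ν* T_α T_β*) = 2^{-|μ|} 3^{-|α|}` if `μ = ν` and `α = β`, and `0` otherwise. -/
def IsO23State {A : Type*} [CStarAlgebra A] (S : Fin 2 → A) (T : Fin 3 → A)
    (φ : A →L[ℂ] ℂ) : Prop :=
  IsState φ ∧ ∀ (μ ν : List (Fin 2)) (α β : List (Fin 3)),
    φ (cuntzWord S μ * star (cuntzWord S ν) * (cuntzWord T α * star (cuntzWord T β))) =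
      if μ = ν ∧ α = β then ((2 : ℂ) ^ μ.length)⁻¹ * ((3 : ℂ) ^ α.length)⁻¹ else 0

/-- `F = F₂ ⊗ F₃`: the C*-subalgebra of the model `A` of `O₂ ⊗ O₃` generated by
`{S_μ S_ν* T_α T_β* : |μ| = |ν|, |α| = |β|}`. -/
def o23F {A : Type*} [CStarAlgebra A] (S : Fin 2 → A) (T : Fin 3 → A) :
    StarSubalgebra ℂ A :=
  (StarAlgebra.adjoin ℂ {x : A | ∃ (μ ν : List (Fin 2)) (α β : List (Fin 3)),
    μ.length = ν.length ∧ α.length = β.length ∧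
    x = cuntzWord S μ * star (cuntzWord S ν) *
      (cuntzWord T α * star (cuntzWord T β))}).topologicalClosure

/-- A Cuntz family: isometries with pairwise orthogonal ranges summing to `1`. -/
structure IsCuntzFamily {A ι : Type*} [CStarAlgebra A] [Fintype ι] [DecidableEq ι]
    (V : ι → A) : Prop where
  star_mul_eq : ∀ i j, star (V i) * V j = if i = j then 1 else 0
  sum_mul_star : ∑ i, V i * star (V i) = 1

/-- The averaged compression `x ↦ |ι|⁻¹ ∑ i, V i* x V i`. -/
noncomputable def compressionMean {A ι : Type*} [CStarAlgebra A] [Fintype ι] (V : ι → A) :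
    A →ₗ[ℂ] A :=
  (Fintype.card ι : ℂ)⁻¹ • ∑ i, (LinearMap.mulLeft ℂ (star (V i))).comp
    (LinearMap.mulRight ℂ (V i))

theorem compressionMean_apply {A ι : Type*} [CStarAlgebra A] [Fintype ι] (V : ι → A) (x : A) :
    compressionMean V x = (Fintype.card ι : ℂ)⁻¹ • ∑ i, star (V i) * x * V i := by
  simp [compressionMean, mul_assoc]

theorem intCast_sign_mul_self (ε : ℤˣ) : ((ε : ℤ) : ℂ) * ((ε : ℤ) : ℂ) = 1 := by
  rw [← Int.cast_mul, ← Units.val_mul, Int.units_mul_self, Units.val_one, Int.cast_one]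

section General

variable {A ι κ : Type*} [CStarAlgebra A] [Fintype ι] [DecidableEq ι] [Fintype κ] [DecidableEq κ]

theorem isCuntzFamily_of_isometries {V : ι → A} (h₁ : ∀ i, star (V i) * V i = 1)
    (h₂ : ∑ i, V i * star (V i) = 1) : IsCuntzFamily V := by
  refine ⟨fun i j => ?_, h₂⟩
  split_ifs with hij
  · rw [← hij, h₁]
  let _ := CStarAlgebra.spectralOrder A
  let _ := CStarAlgebra.spectralOrderedRing A
  have key : ∑ k, star (star (V k) * V j) * (star (V k) * V j) = 1 := by
    calc _ = star (V j) * (∑ k, V k * star (V k)) * V j := by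
          simp only [Finset.mul_sum, Finset.sum_mul, star_mul, star_star, mul_assoc]
      _ = 1 := by rw [h₂, mul_one, h₁]
  rw [← Finset.add_sum_erase _ _ (Finset.mem_univ j)] at key
  simp only [h₁, star_one, mul_one, add_eq_left] at key
  rw [Finset.sum_eq_zero_iff_of_nonneg (fun k _ => star_mul_self_nonneg _)] at key
  exact (CStarRing.star_mul_self_eq_zero_iff _).1
    (key i (Finset.mem_erase.2 ⟨hij, Finset.mem_univ i⟩))

theorem norm_le_one_of_star_mul_self {v : A} (h : star v * v = 1) : ‖v‖ ≤ 1 := by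
  rcases subsingleton_or_nontrivial A with _ | _
  · simp [Subsingleton.elim v 0]
  have h1 : ‖v‖ * ‖v‖ = 1 := by rw [← CStarRing.norm_star_mul_self, h, norm_one]
  nlinarith [norm_nonneg v]

namespace IsCuntzFamily

variable {V : ι → A} {W : κ → A}

theorem norm_le_one (hV : IsCuntzFamily V) (i : ι) : ‖V i‖ ≤ 1 :=
  norm_le_one_of_star_mul_self (by simp [hV.star_mul_eq])

theorem prod (hV : IsCuntzFamily V) (hW : IsCuntzFamily W) :
    IsCuntzFamily (fun p : ι × κ => V p.1 * W p.2) := by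
  constructor
  · rintro ⟨i, k⟩ ⟨j, l⟩
    have : star (V i * W k) * (V j * W l) = star (W k) * (star (V i) * V j) * W l := by
      simp only [star_mul, mul_assoc]
    simp only [this, hV.star_mul_eq, Prod.mk.injEq]
    by_cases h : i = j <;> simp [h, hW.star_mul_eq]
  · have : ∀ p : ι × κ, V p.1 * W p.2 * star (V p.1 * W p.2) =
        V p.1 * (W p.2 * star (W p.2)) * star (V p.1) := by
      intro p; simp only [star_mul, mul_assoc]
    simp only [this, Fintype.sum_prod_type]
    simp only [← Finset.sum_mul, ← Finset.mul_sum, hW.sum_mul_star, mul_one, hV.sum_mul_star]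

theorem norm_compressionMean_le (hV : IsCuntzFamily V) (x : A) :
    ‖compressionMean V x‖ ≤ ‖x‖ := by
  rw [compressionMean_apply, norm_smul, norm_inv, Complex.norm_natCast]
  have h : ‖∑ i, star (V i) * x * V i‖ ≤ Fintype.card ι * ‖x‖ := by
    refine (norm_sum_le_of_le (f := fun i => star (V i) * x * V i) (n := fun _ => ‖x‖) _
      fun i _ => ?_).trans (by simp)
    have h1 := hV.norm_le_one i
    calc ‖star (V i) * x * V i‖ ≤ ‖star (V i)‖ * ‖x‖ * ‖V i‖ := norm_mul₃_le
      _ ≤ 1 * ‖x‖ * 1 := by rw [norm_star]; gcongr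
      _ = ‖x‖ := by ring
  rcases (Fintype.card ι).eq_zero_or_pos with h0 | h0
  · simp [h0]
  · rw [inv_mul_le_iff₀ (by exact_mod_cast h0)]
    exact h

theorem norm_iterate_compressionMean_le (hV : IsCuntzFamily V) (n : ℕ) (x : A) :
    ‖(compressionMean V)^[n] x‖ ≤ ‖x‖ := by
  induction n with
  | zero => simp
  | succ n ih =>
    rw [Function.iterate_succ_apply']
    exact (hV.norm_compressionMean_le _).trans ih

/-- The unital endomorphism `x ↦ ∑ i, V i x V i*` attached to a Cuntz family. -/
noncomputable def endo (hV : IsCuntzFamily V) : A →⋆ₐ[ℂ] A where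
  toFun x := ∑ i, V i * x * star (V i)
  map_one' := by simp [hV.sum_mul_star]
  map_mul' x y := by
    have : ∀ i j, V i * x * star (V i) * (V j * y * star (V j)) =
        V i * x * (star (V i) * V j) * y * star (V j) := by
      intro i j; simp only [mul_assoc]
    simp only [Finset.sum_mul_sum, this, hV.star_mul_eq]
    simp [mul_assoc]
  map_zero' := by simp
  map_add' x y := by simp [mul_add, add_mul, Finset.sum_add_distrib]
  commutes' r := by
    have : ∀ i, V i * (algebraMap ℂ A) r * star (V i) = (algebraMap ℂ A) r * (V i * star (V i)) :=
      fun i => by rw [← Algebra.commutes, mul_assoc]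
    simp only [this, ← Finset.mul_sum, hV.sum_mul_star, mul_one]
  map_star' x := by simp [star_sum, mul_assoc]

theorem norm_endo_le (hV : IsCuntzFamily V) (x : A) : ‖hV.endo x‖ ≤ ‖x‖ :=
  NonUnitalStarAlgHom.norm_apply_le _ x

/-- Signed cyclic permutation unitaries in the matrix algebra spanned by the `V i V j*`. -/
theorem exists_unitary [AddCommGroup ι] (hV : IsCuntzFamily V) (F : StarSubalgebra ℂ A)
    (hF : ∀ i j, V i * star (V j) ∈ F) (g : ι) (ε : ι → ℤˣ) :
    ∃ u ∈ F, u * star u = 1 ∧ star u * u = 1 ∧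
      u = ∑ i, ((ε i : ℤ) : ℂ) • (V (g + i) * star (V i)) := by
  have hstar : star (∑ i, ((ε i : ℤ) : ℂ) • (V (g + i) * star (V i))) =
      ∑ i, ((ε i : ℤ) : ℂ) • (V i * star (V (g + i))) := by
    simp [star_sum]
  refine ⟨_, sum_mem fun i _ => F.smul_mem (hF _ _) _, ?_, ?_, rfl⟩
  · have : ∀ i j, V (g + i) * star (V i) * (V j * star (V (g + j))) =
        V (g + i) * (star (V i) * V j) * star (V (g + j)) := by
      intro i j; simp only [mul_assoc]
    rw [hstar, Finset.sum_mul_sum]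
    simp only [smul_mul_smul_comm, this, hV.star_mul_eq, mul_ite, mul_one, mul_zero, ite_mul,
      zero_mul, smul_ite, smul_zero, Finset.sum_ite_eq, Finset.mem_univ, if_true,
      intCast_sign_mul_self, one_smul]
    rw [← hV.sum_mul_star]
    exact Equiv.sum_comp (Equiv.addLeft g) fun i => V i * star (V i)
  · have : ∀ i j, V i * star (V (g + i)) * (V (g + j) * star (V j)) =
        V i * (star (V (g + i)) * V (g + j)) * star (V j) := by
      intro i j; simp only [mul_assoc]
    rw [hstar, Finset.sum_mul_sum]
    simp only [smul_mul_smul_comm, this, hV.star_mul_eq, mul_ite, mul_one, mul_zero, ite_mul,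
      zero_mul, smul_ite, smul_zero, add_right_inj, Finset.sum_ite_eq, Finset.mem_univ, if_true,
      intCast_sign_mul_self, one_smul]
    exact hV.sum_mul_star

end IsCuntzFamily

theorem sum_sign_mul_sign (i j : ι) :
    ∑ ε : ι → ℤˣ, ((ε i : ℤ) : ℂ) * ((ε j : ℤ) : ℂ) =
      if i = j then (Fintype.card (ι → ℤˣ) : ℂ) else 0 := by
  split_ifs with hij
  · subst hij
    simp only [intCast_sign_mul_self, Finset.sum_const, Finset.card_univ, nsmul_eq_mul, mul_one]
  · have h := Equiv.sum_comp (Equiv.mulLeft (Pi.mulSingle i (-1) : ι → ℤˣ))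
      fun ε => ((ε i : ℤ) : ℂ) * ((ε j : ℤ) : ℂ)
    simp only [Equiv.coe_mulLeft, Pi.mul_apply, Pi.mulSingle_eq_same,
      Pi.mulSingle_eq_of_ne (Ne.symm hij), one_mul, Units.val_neg, Int.cast_neg, neg_mul,
       Finset.sum_neg_distrib] at h
    exact self_eq_neg.1 h.symm

/-- The average over all signed cyclic permutations is the expectation onto the commutant of the
matrix algebra spanned by the `V i V j*`. -/
theorem IsCuntzFamily.endo_compressionMean_mem_convexHull [AddCommGroup ι] {V : ι → A}
    (hV : IsCuntzFamily V) (F : StarSubalgebra ℂ A) (hF : ∀ i j, V i * star (V j) ∈ F) (x : A) :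
    hV.endo (compressionMean V x) ∈ convexHull ℝ
      {y : A | ∃ u : A, u ∈ F ∧ u * star u = 1 ∧ star u * u = 1 ∧ y = u * x * star u} := by
  choose u huF hu₁ hu₂ hu using fun p : ι × (ι → ℤˣ) => hV.exists_unitary F hF p.1 p.2
  have hcard : (0 : ℝ) < Fintype.card (ι × (ι → ℤˣ)) := by exact_mod_cast Fintype.card_pos
  have hmem : ∑ p, (Fintype.card (ι × (ι → ℤˣ)) : ℝ)⁻¹ • (u p * x * star (u p)) ∈ convexHull ℝ
      {y : A | ∃ u : A, u ∈ F ∧ u * star u = 1 ∧ star u * u = 1 ∧ y = u * x * star u} := by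
    refine (convex_convexHull ℝ _).sum_mem (fun _ _ => by positivity) ?_ fun p _ =>
      subset_convexHull ℝ _ ⟨u p, huF p, hu₁ p, hu₂ p, rfl⟩
    rw [Finset.sum_const, Finset.card_univ, nsmul_eq_mul, mul_inv_cancel₀ hcard.ne']
  convert hmem using 1
  have hsign : ∀ g : ι, ∑ ε : ι → ℤˣ, u (g, ε) * x * star (u (g, ε)) =
      (Fintype.card (ι → ℤˣ) : ℂ) •
        ∑ i, V (g + i) * star (V i) * x * (V i * star (V (g + i))) := by
    intro g
    have h1 : ∀ ε : ι → ℤˣ, u (g, ε) * x * star (u (g, ε)) = ∑ i, ∑ j,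
        (((ε i : ℤ) : ℂ) * ((ε j : ℤ) : ℂ)) •
          (V (g + i) * star (V i) * x * (V j * star (V (g + j)))) := by
      intro ε
      rw [hu]
      simp only [star_sum, star_smul, Finset.sum_mul, Finset.mul_sum, smul_mul_assoc,
        mul_smul_comm]
      simp
      rw [Finset.sum_comm]
      simp only [Finset.smul_sum, smul_smul, mul_comm]
    simp only [h1]
    rw [Finset.sum_comm]
    simp_rw [Finset.sum_comm (s := (Finset.univ : Finset (ι → ℤˣ))), ← Finset.sum_smul,
      sum_sign_mul_sign]
    simp [Finset.smul_sum]
  rw [← Finset.smul_sum, Fintype.sum_prod_type]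
  simp only [hsign]
  have hg : ∑ g, ∑ i, V (g + i) * star (V i) * x * (V i * star (V (g + i))) =
      ∑ k, ∑ i, V k * (star (V i) * x * V i) * star (V k) := by
    rw [Finset.sum_comm]
    conv_rhs => rw [Finset.sum_comm]
    refine Finset.sum_congr rfl fun i _ => ?_
    simpa only [Equiv.coe_addRight, mul_assoc] using
      Equiv.sum_comp (Equiv.addRight i) fun k => V k * (star (V i) * x * V i) * star (V k)
  rw [← Finset.smul_sum, hg, compressionMean_apply, map_smul]
  have he : hV.endo (∑ i, star (V i) * x * V i) =
      ∑ k, ∑ i, V k * (star (V i) * x * V i) * star (V k) := by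
    change ∑ k, V k * _ * star (V k) = _
    simp only [Finset.sum_mul, Finset.mul_sum]
  rw [he, ← Complex.coe_smul, smul_smul]
  congr 1
  have h2 : (Fintype.card (ι → ℤˣ) : ℂ) ≠ 0 := by exact_mod_cast Fintype.card_ne_zero
  rw [Fintype.card_prod]
  push_cast
  rw [mul_inv, mul_assoc, inv_mul_cancel₀ h2, mul_one]

end General

section Words

open Filter Topology

variable {A : Type*} [CStarAlgebra A] {d : ℕ} {S : Fin d → A}

theorem cuntzWord_cons {A : Type*} [Monoid A] (S : Fin d → A) (i : Fin d) (μ : List (Fin d)) :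
    cuntzWord S (i :: μ) = S i * cuntzWord S μ := by simp [cuntzWord]

theorem cuntzWord_nil {A : Type*} [Monoid A] (S : Fin d → A) : cuntzWord S [] = 1 := rfl

theorem cuntzWord_concat {A : Type*} [Monoid A] (S : Fin d → A) (i : Fin d) (μ : List (Fin d)) :
    cuntzWord S (μ ++ [i]) = cuntzWord S μ * S i := by simp [cuntzWord]

theorem commute_cuntzWord {A : Type*} [Monoid A] {S : Fin d → A} {a : A}
    (h : ∀ i, Commute a (S i)) (μ : List (Fin d)) : Commute a (cuntzWord S μ) := by
  induction μ with
  | nil => exact Commute.one_right a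
  | cons i μ ih => rw [cuntzWord_cons]; exact (h i).mul_right ih

theorem IsCuntzFamily.norm_cuntzWord_le (hS : IsCuntzFamily S) (μ : List (Fin d)) :
    ‖cuntzWord S μ‖ ≤ 1 := by
  refine norm_le_one_of_star_mul_self ?_
  induction μ with
  | nil => simp [cuntzWord_nil]
  | cons i μ ih =>
    rw [cuntzWord_cons, star_mul, mul_assoc, ← mul_assoc (star (S i)), hS.star_mul_eq, if_pos rfl,
      one_mul, ih]

theorem compressionMean_star (x : A) :
    compressionMean S (star x) = star (compressionMean S x) := by
  simp [compressionMean_apply, star_sum, mul_assoc]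

theorem IsCuntzFamily.compressionMean_cuntzWord_cons (hS : IsCuntzFamily S) (i : Fin d)
    (μ : List (Fin d)) :
    compressionMean S (cuntzWord S (i :: μ)) = (d : ℂ)⁻¹ • cuntzWord S (μ ++ [i]) := by
  rw [compressionMean_apply]
  simp only [cuntzWord_cons, cuntzWord_concat, ← mul_assoc, hS.star_mul_eq]
  simp

theorem IsCuntzFamily.compressionMean_cons_cons (hS : IsCuntzFamily S) (i j : Fin d)
    (μ ν : List (Fin d)) :
    compressionMean S (cuntzWord S (i :: μ) * star (cuntzWord S (j :: ν))) =
      (if i = j then (d : ℂ)⁻¹ else 0) • (cuntzWord S μ * star (cuntzWord S ν)) := by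
  rw [compressionMean_apply]
  have : ∀ k, star (S k) * (cuntzWord S (i :: μ) * star (cuntzWord S (j :: ν))) * S k =
      (star (S k) * S i) * (cuntzWord S μ * star (cuntzWord S ν)) * (star (S j) * S k) := by
    intro k; simp only [cuntzWord_cons, star_mul, mul_assoc]
  simp only [this, hS.star_mul_eq]
  by_cases h : i = j
  · subst h; simp
  · simp [h, Ne.symm h]

theorem IsCuntzFamily.norm_iterate_compressionMean_cuntzWord_le (hS : IsCuntzFamily S) (n : ℕ)
    {μ : List (Fin d)} (hμ : μ ≠ []) :
    ‖(compressionMean S)^[n] (cuntzWord S μ)‖ ≤ ((d : ℝ)⁻¹) ^ n := by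
  induction n generalizing μ with
  | zero => simpa using hS.norm_cuntzWord_le μ
  | succ n ih =>
    obtain ⟨i, μ, rfl⟩ := List.exists_cons_of_ne_nil hμ
    rw [Function.iterate_succ_apply, hS.compressionMean_cuntzWord_cons, ← Module.End.pow_apply,
      map_smul, Module.End.pow_apply, norm_smul, pow_succ', norm_inv, Complex.norm_natCast]
    gcongr
    exact ih (by simp)

theorem IsCuntzFamily.tendsto_iterate_compressionMean (hS : IsCuntzFamily S) (hd : 2 ≤ d)
    (μ ν : List (Fin d)) :
    Tendsto (fun n => (compressionMean S)^[n] (cuntzWord S μ * star (cuntzWord S ν))) atTop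
      (𝓝 ((if μ = ν then ((d : ℂ) ^ μ.length)⁻¹ else 0) • (1 : A))) := by
  have hword : ∀ μ : List (Fin d), μ ≠ [] →
      Tendsto (fun n => (compressionMean S)^[n] (cuntzWord S μ)) atTop (𝓝 0) := fun μ hμ =>
    squeeze_zero_norm (fun n => hS.norm_iterate_compressionMean_cuntzWord_le n hμ)
      (tendsto_pow_atTop_nhds_zero_of_lt_one (by positivity)
        (inv_lt_one_of_one_lt₀ (by exact_mod_cast hd)))
  have hstar : ∀ (n : ℕ) (x : A), (compressionMean S)^[n] (star x) =
      star ((compressionMean S)^[n] x) := fun n x =>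
    ((Function.Commute.iterate_left (f := compressionMean S) (g := star)
      compressionMean_star n) x)
  induction μ generalizing ν with
  | nil =>
    cases ν with
    | nil =>
      have h1 : compressionMean S (1 : A) = 1 := by
        have : (d : ℂ) ≠ 0 := by exact_mod_cast (by omega : d ≠ 0)
        rw [compressionMean_apply]
        simp only [mul_one, hS.star_mul_eq, if_true, Finset.sum_const, Finset.card_univ,
          Fintype.card_fin]
        rw [← Nat.cast_smul_eq_nsmul ℂ, smul_smul, inv_mul_cancel₀ this, one_smul]
      simp [cuntzWord_nil, Function.iterate_fixed h1]
    | cons j ν =>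
      simpa [cuntzWord_nil, hstar] using (hword (j :: ν) (by simp)).star
  | cons i μ ih =>
    cases ν with
    | nil => simpa [cuntzWord_nil] using hword (i :: μ) (by simp)
    | cons j ν =>
      rw [← tendsto_add_atTop_iff_nat 1]
      simp only [Function.iterate_succ_apply, hS.compressionMean_cons_cons]
      simp only [← Module.End.pow_apply, map_smul]
      simp only [Module.End.pow_apply]
      convert (ih ν).const_smul (if i = j then (d : ℂ)⁻¹ else 0) using 2
      by_cases h : i = j <;> by_cases h' : μ = ν <;>
        simp [h, h', smul_smul, pow_succ, mul_comm]

end Words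

section Tensor

open Filter Topology

variable {A : Type*} [CStarAlgebra A] {S : Fin 2 → A} {T : Fin 3 → A}

theorem compressionMean_mul {a b : A} (hST : ∀ i j, Commute (S i) (T j))
    (hST' : ∀ i j, Commute (S i) (star (T j)))
    (ha : ∀ j, Commute a (T j) ∧ Commute a (star (T j)))
    (hb : ∀ i, Commute b (S i)) :
    compressionMean (fun p : Fin 2 × Fin 3 => S p.1 * T p.2) (a * b) =
      compressionMean S a * compressionMean T b := by
  have key : ∀ i j, star (S i * T j) * (a * b) * (S i * T j) =
      (star (S i) * a * S i) * (star (T j) * b * T j) := by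
    intro i j
    have h1 : Commute (star (S i)) (star (T j)) := (hST i j).star_star
    calc star (S i * T j) * (a * b) * (S i * T j)
        = star (T j) * star (S i) * a * (b * S i) * T j := by simp only [star_mul, mul_assoc]
      _ = star (S i) * (star (T j) * a) * S i * b * T j := by
          rw [(hb i).eq, ← h1.eq]; simp only [mul_assoc]
      _ = star (S i) * a * (star (T j) * S i) * b * T j := by
          rw [← (ha j).2.eq]; simp only [mul_assoc]
      _ = _ := by rw [← (hST' i j).eq]; simp only [mul_assoc]
  simp only [compressionMean_apply, key, Fintype.sum_prod_type, Fintype.card_prod,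
    smul_mul_smul_comm, Finset.sum_mul_sum, Nat.cast_mul, mul_inv]

theorem commute_compressionMean {ι : Type*} [Fintype ι] {V : ι → A} {a t : A}
    (hV : ∀ i, Commute (V i) t) (hV' : ∀ i, Commute (star (V i)) t) (ha : Commute a t) :
    Commute (compressionMean V a) t := by
  rw [compressionMean_apply]
  exact (Commute.sum_left _ _ _ fun i _ => ((hV' i).mul_left ha).mul_left (hV i)).smul_left _

theorem iterate_compressionMean_mul (hST : ∀ i j, Commute (S i) (T j))
    (hST' : ∀ i j, Commute (S i) (star (T j))) (n : ℕ) {a b : A}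
    (ha : ∀ j, Commute a (T j) ∧ Commute a (star (T j)))
    (hb : ∀ i, Commute b (S i)) :
    (compressionMean (fun p : Fin 2 × Fin 3 => S p.1 * T p.2))^[n] (a * b) =
      (compressionMean S)^[n] a * (compressionMean T)^[n] b := by
  induction n generalizing a b with
  | zero => rfl
  | succ n ih =>
    have hS'T : ∀ i j, Commute (star (S i)) (T j) := fun i j => by
      simpa using (hST' i j).star_star
    simp only [Function.iterate_succ_apply]
    rw [compressionMean_mul hST hST' ha hb]
    exact ih (fun j => ⟨commute_compressionMean (fun i => hST i j) (fun i => hS'T i j) (ha j).1,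
      commute_compressionMean (fun i => hST' i j) (fun i => (hST i j).star_star) (ha j).2⟩)
      fun i => commute_compressionMean (fun j => (hST i j).symm) (fun j => (hST' i j).symm) (hb i)

/-- The linear span of the elements `S_μ S_ν* T_α T_β*`. -/
noncomputable def o23Span (S : Fin 2 → A) (T : Fin 3 → A) : Submodule ℂ A :=
  Submodule.span ℂ {x : A | ∃ (μ ν : List (Fin 2)) (α β : List (Fin 3)),
    x = cuntzWord S μ * star (cuntzWord S ν) * (cuntzWord T α * star (cuntzWord T β))}

theorem IsCuntzFamily.star_mul_word_mem {d : ℕ} {S : Fin d → A} (hS : IsCuntzFamily S)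
    (i : Fin d) (μ ν : List (Fin d)) :
    star (S i) * (cuntzWord S μ * star (cuntzWord S ν)) = 0 ∨
      ∃ μ' ν', star (S i) * (cuntzWord S μ * star (cuntzWord S ν)) =
        cuntzWord S μ' * star (cuntzWord S ν') := by
  cases μ with
  | nil => exact Or.inr ⟨[], ν ++ [i], by simp [cuntzWord_nil, cuntzWord_concat]⟩
  | cons k μ =>
    rw [cuntzWord_cons, mul_assoc, ← mul_assoc, hS.star_mul_eq]
    by_cases h : i = k
    · exact Or.inr ⟨μ, ν, by simp [h]⟩
    · simp [h]

theorem adjoin_le_o23Span (hS : IsCuntzFamily S) (hT : IsCuntzFamily T)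
    (hST : ∀ i j, Commute (S i) (T j)) (hST' : ∀ i j, Commute (S i) (star (T j))) {a : A}
    (ha : a ∈ StarAlgebra.adjoin ℂ (Set.range S ∪ Set.range T)) : a ∈ o23Span S T := by
  have hgen : ∀ c : A, (∀ μ ν α β, c * (cuntzWord S μ * star (cuntzWord S ν) *
      (cuntzWord T α * star (cuntzWord T β))) ∈ o23Span S T) →
      ∀ x ∈ o23Span S T, c * x ∈ o23Span S T := by
    intro c hc x hx
    have : o23Span S T ≤ (o23Span S T).comap (LinearMap.mulLeft ℂ c) := by
      refine Submodule.span_le.2 ?_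
      rintro _ ⟨μ, ν, α, β, rfl⟩
      exact hc μ ν α β
    exact this hx
  have hword : ∀ μ ν α β, cuntzWord S μ * star (cuntzWord S ν) *
      (cuntzWord T α * star (cuntzWord T β)) ∈ o23Span S T := fun μ ν α β =>
    Submodule.subset_span ⟨μ, ν, α, β, rfl⟩
  have hS'T : ∀ i j, Commute (star (S i)) (T j) := fun i j => by
    simpa using (hST' i j).star_star
  have hTword : ∀ j μ ν, Commute (T j) (cuntzWord S μ * star (cuntzWord S ν)) := fun j μ ν =>
    (commute_cuntzWord (fun i => (hST i j).symm) μ).mul_right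
      (by simpa using (commute_cuntzWord (fun i => (hST' i j).symm) ν).star_star)
  have hT'word : ∀ j μ ν, Commute (star (T j)) (cuntzWord S μ * star (cuntzWord S ν)) :=
    fun j μ ν => (commute_cuntzWord (fun i => (hST' i j).symm) μ).mul_right
      (commute_cuntzWord (fun i => (hST i j).symm) ν).star_star
  have key : (∀ x ∈ o23Span S T, a * x ∈ o23Span S T) ∧
      ∀ x ∈ o23Span S T, star a * x ∈ o23Span S T := by
    induction ha using StarAlgebra.adjoin_induction with
    | mem c hc =>
      rcases hc with ⟨i, rfl⟩ | ⟨j, rfl⟩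
      · refine ⟨hgen _ fun μ ν α β => ?_, hgen _ fun μ ν α β => ?_⟩
        · rw [← mul_assoc, ← mul_assoc (S i), ← cuntzWord_cons]
          exact hword _ _ _ _
        · rw [← mul_assoc]
          rcases hS.star_mul_word_mem i μ ν with h | ⟨μ', ν', h⟩
          · rw [h, zero_mul]; exact zero_mem _
          · rw [h]; exact hword _ _ _ _
      · refine ⟨hgen _ fun μ ν α β => ?_, hgen _ fun μ ν α β => ?_⟩
        · rw [← mul_assoc, (hTword j μ ν).eq, mul_assoc, ← mul_assoc (T j), ← cuntzWord_cons]
          exact hword _ _ _ _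
        · rw [← mul_assoc, (hT'word j μ ν).eq, mul_assoc]
          rcases hT.star_mul_word_mem j α β with h | ⟨α', β', h⟩
          · rw [h, mul_zero]; exact zero_mem _
          · rw [h]; exact hword _ _ _ _
    | algebraMap r =>
      refine ⟨fun x hx => ?_, fun x hx => ?_⟩
      · rw [← Algebra.smul_def]; exact Submodule.smul_mem _ _ hx
      · rw [← algebraMap_star_comm, ← Algebra.smul_def]; exact Submodule.smul_mem _ _ hx
    | add b c _ _ hb hc =>
      refine ⟨fun x hx => ?_, fun x hx => ?_⟩
      · rw [add_mul]; exact add_mem (hb.1 x hx) (hc.1 x hx)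
      · rw [star_add, add_mul]; exact add_mem (hb.2 x hx) (hc.2 x hx)
    | mul b c _ _ hb hc =>
      refine ⟨fun x hx => ?_, fun x hx => ?_⟩
      · rw [mul_assoc]; exact hb.1 _ (hc.1 x hx)
      · rw [star_mul, mul_assoc]; exact hc.2 _ (hb.2 x hx)
    | star b _ hb => exact ⟨hb.2, by simpa using hb.1⟩
  simpa [cuntzWord_nil] using key.1 _ (hword [] [] [] [])

/-- The averaged compressions converge pointwise in norm to the canonical state. -/
theorem tendsto_iterate_compressionMean_state (hS : IsCuntzFamily S) (hT : IsCuntzFamily T)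
    (hST : ∀ i j, Commute (S i) (T j)) (hST' : ∀ i j, Commute (S i) (star (T j)))
    (hgen : (StarAlgebra.adjoin ℂ (Set.range S ∪ Set.range T)).topologicalClosure = ⊤)
    {φ : A →L[ℂ] ℂ} (hφ : IsO23State S T φ) (x : A) :
    Tendsto (fun n => (compressionMean (fun p : Fin 2 × Fin 3 => S p.1 * T p.2))^[n] x) atTop
      (𝓝 (φ x • (1 : A))) := by
  set Φ := compressionMean (fun p : Fin 2 × Fin 3 => S p.1 * T p.2) with hΦ
  have hspan : ∀ y ∈ o23Span S T, Tendsto (fun n => Φ^[n] y) atTop (𝓝 (φ y • (1 : A))) := by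
    intro y hy
    simp only [← Module.End.pow_apply]
    induction hy using Submodule.span_induction with
    | mem y hy =>
      obtain ⟨μ, ν, α, β, rfl⟩ := hy
      have h := (hS.tendsto_iterate_compressionMean le_rfl μ ν).mul
        (hT.tendsto_iterate_compressionMean (by norm_num) α β)
      rw [hφ.2 μ ν α β]
      convert h using 2
      · rw [Module.End.pow_apply]
        refine iterate_compressionMean_mul hST hST' _ (fun j => ⟨?_, ?_⟩) fun i => ?_
        · refine Commute.mul_left (commute_cuntzWord (fun i => (hST i j).symm) μ).symm ?_
          simpa using (commute_cuntzWord (fun i => (hST' i j).symm) ν).star_star.symm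
        · exact Commute.mul_left (commute_cuntzWord (fun i => (hST' i j).symm) μ).symm
            (commute_cuntzWord (fun i => (hST i j).symm) ν).star_star.symm
        · refine Commute.mul_left (commute_cuntzWord (fun j => hST i j) α).symm ?_
          have := (commute_cuntzWord (a := star (S i)) (S := T)
            (fun j => by simpa using (hST' i j).star_star) β).star_star.symm
          simpa using this
      · by_cases h₁ : μ = ν <;> by_cases h₂ : α = β <;> simp [h₁, h₂, smul_smul, mul_comm]
    | zero => simp
    | add y z _ _ hy hz => simpa [add_smul] using hy.add hz
    | smul c y _ hy => simpa [smul_smul] using hy.const_smul c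
  rw [Metric.tendsto_atTop]
  intro ε hε
  have hx : x ∈ closure ((StarAlgebra.adjoin ℂ (Set.range S ∪ Set.range T) : Set A)) := by
    rw [← StarSubalgebra.topologicalClosure_coe, hgen]; trivial
  set C := ‖φ‖ * ‖(1 : A)‖ with hC
  have hC0 : 0 ≤ C := by positivity
  obtain ⟨y, hy, hxy⟩ := Metric.mem_closure_iff.1 hx (ε / (2 * (1 + C))) (by positivity)
  obtain ⟨N, hN⟩ := Metric.tendsto_atTop.1
    (hspan y (adjoin_le_o23Span hS hT hST hST' hy)) (ε / 2) (by positivity)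
  refine ⟨N, fun n hn => ?_⟩
  have h1 : dist (Φ^[n] x) (Φ^[n] y) ≤ dist x y := by
    rw [dist_eq_norm, dist_eq_norm]
    simp only [← Module.End.pow_apply, ← map_sub]
    rw [Module.End.pow_apply]
    exact (hS.prod hT).norm_iterate_compressionMean_le n _
  have h2 : dist (φ y • (1 : A)) (φ x • (1 : A)) ≤ C * dist x y := by
    rw [dist_comm, dist_eq_norm, ← sub_smul, ← map_sub, norm_smul, dist_eq_norm]
    calc ‖φ (x - y)‖ * ‖(1 : A)‖ ≤ (‖φ‖ * ‖x - y‖) * ‖(1 : A)‖ := by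
          gcongr; exact φ.le_opNorm _
      _ = C * ‖x - y‖ := by rw [hC]; ring
  have h3 : (1 + C) * dist x y < ε / 2 := by
    rw [lt_div_iff₀ (by positivity)] at hxy
    linarith
  calc dist (Φ^[n] x) (φ x • (1 : A))
      ≤ dist (Φ^[n] x) (Φ^[n] y) + dist (Φ^[n] y) (φ y • (1 : A)) +
        dist (φ y • (1 : A)) (φ x • (1 : A)) := dist_triangle4 _ _ _ _
    _ < ε := by linarith [hN n hn]

/-- The length-`n` words form a Cuntz family whose averaged compression is the `n`-th iterate. -/
theorem exists_wordFamily (hS : IsCuntzFamily S) (hT : IsCuntzFamily T)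
    (hST : ∀ i j, Commute (S i) (T j)) (n : ℕ) :
    ∃ (ι : Type) (_ : Fintype ι) (_ : DecidableEq ι) (_ : AddCommGroup ι) (V : ι → A),
      IsCuntzFamily V ∧
      (∀ x, (compressionMean (fun p : Fin 2 × Fin 3 => S p.1 * T p.2))^[n] x =
        compressionMean V x) ∧
      ∀ i, ∃ (μ : List (Fin 2)) (α : List (Fin 3)), μ.length = n ∧ α.length = n ∧
        V i = cuntzWord S μ * cuntzWord T α := by
  induction n with
  | zero =>
    refine ⟨Fin 1, inferInstance, inferInstance, inferInstance, fun _ => 1, ⟨?_, ?_⟩, ?_, ?_⟩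
    · intro i j; simp [Subsingleton.elim i j]
    · simp
    · intro x; simp [compressionMean_apply]
    · exact fun _ => ⟨[], [], rfl, rfl, by simp [cuntzWord_nil]⟩
  | succ n ih =>
    obtain ⟨ι, _, _, _, V, hV, hVn, hVw⟩ := ih
    refine ⟨ι × (Fin 2 × Fin 3), inferInstance, inferInstance, inferInstance, _,
      hV.prod (hS.prod hT), fun x => ?_, fun i => ?_⟩
    · rw [Function.iterate_succ_apply', hVn]
      simp only [compressionMean_apply, Fintype.sum_prod_type (α₁ := ι), Fintype.card_prod]
      rw [Finset.sum_comm]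
      simp only [mul_smul_comm, smul_mul_assoc, ← Finset.smul_sum, smul_smul, star_mul,
        Finset.mul_sum, Finset.sum_mul, mul_assoc]
      simp [mul_comm]
    · obtain ⟨μ, α, hμ, hα, h⟩ := hVw i.1
      refine ⟨μ ++ [i.2.1], α ++ [i.2.2], by simp [hμ], by simp [hα], ?_⟩
      rw [h, cuntzWord_concat, cuntzWord_concat, mul_assoc, mul_assoc, ← mul_assoc (cuntzWord T α),
        ← (commute_cuntzWord (hST i.2.1) α).eq]
      simp only [mul_assoc]

end Tensor

/-- Dixmier-type averaging property for the model `A` of `O₂ ⊗ O₃` relative to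
`F = F₂ ⊗ F₃`: for every `x ∈ A`, the scalar `φ(x)·1` lies in the norm closure of the convex
hull of `{u x u* : u unitary in F}`. -/
theorem o23_dixmier_property {A : Type*} [CStarAlgebra A]
    (S : Fin 2 → A) (T : Fin 3 → A)
    (hSiso : ∀ i, star (S i) * S i = 1) (hSsum : ∑ i, S i * star (S i) = 1)
    (hTiso : ∀ j, star (T j) * T j = 1) (hTsum : ∑ j, T j * star (T j) = 1)
    (hST : ∀ i j, S i * T j = T j * S i)
    (hSTstar : ∀ i j, S i * star (T j) = star (T j) * S i)
    (hgen : (StarAlgebra.adjoin ℂ (Set.range S ∪ Set.range T)).topologicalClosure = ⊤)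
    (φ : A →L[ℂ] ℂ) (hφ : IsO23State S T φ) (x : A) :
    φ x • (1 : A) ∈ closure (convexHull ℝ
      {y : A | ∃ u : A, u ∈ o23F S T ∧ u * star u = 1 ∧ star u * u = 1 ∧
        y = u * x * star u}) := by
  have hS := isCuntzFamily_of_isometries hSiso hSsum
  have hT := isCuntzFamily_of_isometries hTiso hTsum
  have hlim := tendsto_iterate_compressionMean_state hS hT hST hSTstar hgen hφ x
  rw [Metric.mem_closure_iff]
  intro ε hε
  obtain ⟨n, hn⟩ := (Metric.tendsto_atTop.1 hlim ε hε)
  obtain ⟨ι, _, _, _, V, hV, hVn, hVw⟩ := exists_wordFamily hS hT hST n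
  refine ⟨_, hV.endo_compressionMean_mem_convexHull (o23F S T) (fun i j => ?_) x, ?_⟩
  · obtain ⟨μ, α, hμ, hα, hi⟩ := hVw i
    obtain ⟨ν, β, hν, hβ, hj⟩ := hVw j
    refine StarSubalgebra.le_topologicalClosure _ (StarAlgebra.subset_adjoin ℂ _
      ⟨μ, ν, α, β, hμ.trans hν.symm, hα.trans hβ.symm, ?_⟩)
    have h₁ : Commute (cuntzWord T α) (star (cuntzWord S ν)) := by
      have : ∀ k, Commute (star (cuntzWord T α)) (S k) := fun k => by
        have := (commute_cuntzWord (a := star (S k)) (S := T)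
          (fun l => by simpa using (Commute.star_star (hSTstar k l))) α).star_star.symm
        simpa using this
      simpa using (commute_cuntzWord this ν).star_star
    have h₂ : Commute (star (cuntzWord T β)) (star (cuntzWord S ν)) :=
      (commute_cuntzWord (fun k => (commute_cuntzWord (hST k) β).symm) ν).star_star
    rw [hi, hj, star_mul]
    calc _ = cuntzWord S μ * (cuntzWord T α * star (cuntzWord T β) * star (cuntzWord S ν)) := by
          simp only [mul_assoc]
      _ = _ := by rw [(h₁.mul_left h₂).eq]; simp only [mul_assoc]
  · have h1 : hV.endo (φ x • (1 : A)) = φ x • (1 : A) := by simp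
    rw [dist_comm, ← h1, dist_eq_norm, ← map_sub]
    refine (hV.norm_endo_le _).trans_lt ?_
    rw [← hVn, ← dist_eq_norm]
    exact hn n le_rfl
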